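/- For any S-complex C~ over a commutative ring R, the suspension ΣC~ is S-chain homotopy equivalent to the tensor product C~ ⊗ O~(1). -/

import Mathlib

set_option maxHeartbeats 1000000

open Function

universe u

/-- A `ℤ`-graded `R`-module, presented as an `R`-module together with a family of submodules
(the homogeneous pieces). -/
structure GradedMod (R : Type u) [CommRing R] : Type (u + 1) where
  carrier : Type u
  [isAddCommGroup : AddCommGroup carrier]
  [isModule : Module R carrier]
  grading : ℤ → Submodule R carrier

attribute [instance] GradedMod.isAddCommGroup GradedMod.isModule

namespace GradedMod

variable {R : Type u} [CommRing R]

/-- `f` is homogeneous of degree `k` with respect to the gradings. -/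
def IsDeg (M N : GradedMod R) (k : ℤ) (f : M.carrier →ₗ[R] N.carrier) : Prop :=
  ∀ i : ℤ, (M.grading i).map f ≤ N.grading (i + k)

/-- The grading is an internal direct sum decomposition with finitely generated free pieces,
only finitely many of which are nonzero; i.e., the graded module is finitely generated and
free as a graded `R`-module. -/
def IsFGFree (M : GradedMod R) : Prop :=
  DirectSum.IsInternal M.grading ∧ (∀ i : ℤ, Module.Free R ↥(M.grading i)) ∧
    (∀ i : ℤ, Module.Finite R ↥(M.grading i)) ∧ {i : ℤ | M.grading i ≠ ⊥}.Finite

/-- `e` is the sign operator `ε`, acting on the degree `i` homogeneous part by `(-1)^i`. -/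
def IsSign (M : GradedMod R) (e : M.carrier →ₗ[R] M.carrier) : Prop :=
  ∀ i : ℤ, ∀ x ∈ M.grading i, e x = if Even i then x else -x

/-- The shift `M[n]`, with `M[n]_j = M_{n+j}`. -/
def shift (M : GradedMod R) (n : ℤ) : GradedMod R where
  carrier := M.carrier
  grading j := M.grading (n + j)

/-- Direct sum (product) of graded modules. -/
def prodGM (M N : GradedMod R) : GradedMod R where
  carrier := M.carrier × N.carrier
  grading j := (M.grading j).prod (N.grading j)

/-- Tensor product of graded modules, `(M ⊗ N)_k = ⊕_{i+j=k} M_i ⊗ N_j`. -/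
noncomputable def tensorGM (M N : GradedMod R) : GradedMod R where
  carrier := TensorProduct R M.carrier N.carrier
  grading k := ⨆ i : ℤ, Submodule.map₂ (TensorProduct.mk R M.carrier N.carrier)
      (M.grading i) (N.grading (k - i))

/-- Dual of a graded module: a functional has degree `-i` if it kills all `M_j`, `j ≠ i`. -/
def dualGM (M : GradedMod R) : GradedMod R where
  carrier := Module.Dual R M.carrier
  grading j := ⨅ (i : ℤ) (_ : i ≠ -j), (M.grading i).dualAnnihilator

end GradedMod

variable {R : Type u} [CommRing R]

/-- Iterated composition of a linear endomorphism. -/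
def lpow {M : Type u} [AddCommGroup M] [Module R M] (f : M →ₗ[R] M) : ℕ → (M →ₗ[R] M)
  | 0 => LinearMap.id
  | n + 1 => f ∘ₗ lpow f n

section ProdHelpers

variable {A B C D E : Type u} [AddCommGroup A] [Module R A] [AddCommGroup B] [Module R B]
  [AddCommGroup C] [Module R C] [AddCommGroup D] [Module R D] [AddCommGroup E] [Module R E]

def pj₁ : (A × B × C) →ₗ[R] A := LinearMap.fst R A (B × C)
def pj₂ : (A × B × C) →ₗ[R] B := (LinearMap.fst R B C) ∘ₗ (LinearMap.snd R A (B × C))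
def pj₃ : (A × B × C) →ₗ[R] C := (LinearMap.snd R B C) ∘ₗ (LinearMap.snd R A (B × C))

def tri (f : D →ₗ[R] A) (g : D →ₗ[R] B) (h : D →ₗ[R] C) : D →ₗ[R] A × B × C :=
  f.prod (g.prod h)

def qj₁ : (A × B × C × D) →ₗ[R] A := LinearMap.fst R A (B × C × D)
def qj₂ : (A × B × C × D) →ₗ[R] B := (LinearMap.fst R B (C × D)) ∘ₗ (LinearMap.snd R A (B × C × D))
def qj₃ : (A × B × C × D) →ₗ[R] C :=
  (LinearMap.fst R C D) ∘ₗ (LinearMap.snd R B (C × D)) ∘ₗ (LinearMap.snd R A (B × C × D))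
def qj₄ : (A × B × C × D) →ₗ[R] D :=
  (LinearMap.snd R C D) ∘ₗ (LinearMap.snd R B (C × D)) ∘ₗ (LinearMap.snd R A (B × C × D))

def quad (f : E →ₗ[R] A) (g : E →ₗ[R] B) (h : E →ₗ[R] C) (l : E →ₗ[R] D) :
    E →ₗ[R] A × B × C × D := f.prod (g.prod (h.prod l))

end ProdHelpers

/-- The data of an `S`-complex over `R`: graded modules `C` (irreducible summand) and
`𝖱` (reducible summand), together with the component maps of the differential
`d~ = [[d, 0, 0], [v, −d, δ₂], [δ₁, 0, r]]` with respect to `C~ = C ⊕ C[-1] ⊕ 𝖱`. -/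
structure SCData (R : Type u) [CommRing R] : Type (u + 1) where
  Irr : GradedMod R
  Red : GradedMod R
  d : Irr.carrier →ₗ[R] Irr.carrier
  v : Irr.carrier →ₗ[R] Irr.carrier
  δ₁ : Irr.carrier →ₗ[R] Red.carrier
  δ₂ : Red.carrier →ₗ[R] Irr.carrier
  r : Red.carrier →ₗ[R] Red.carrier

namespace SCData

/-- The five relations equivalent to `d~ ∘ d~ = 0`. -/
def Relations (S : SCData R) : Prop :=
  S.d ∘ₗ S.d = 0 ∧
  S.δ₁ ∘ₗ S.d + S.r ∘ₗ S.δ₁ = 0 ∧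
  S.d ∘ₗ S.δ₂ - S.δ₂ ∘ₗ S.r = 0 ∧
  S.d ∘ₗ S.v - S.v ∘ₗ S.d - S.δ₂ ∘ₗ S.δ₁ = 0 ∧
  S.r ∘ₗ S.r = 0

/-- The degree conditions making `d~` a degree `−1` map on `C~ = C ⊕ C[-1] ⊕ 𝖱`. -/
def Degrees (S : SCData R) : Prop :=
  S.Irr.IsDeg S.Irr (-1) S.d ∧ S.Irr.IsDeg S.Irr (-2) S.v ∧
  S.Irr.IsDeg S.Red (-1) S.δ₁ ∧ S.Red.IsDeg S.Irr (-2) S.δ₂ ∧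
  S.Red.IsDeg S.Red (-1) S.r

/-- `S` is an `S`-complex. -/
def IsSComplex (S : SCData R) : Prop :=
  S.Irr.IsFGFree ∧ S.Red.IsFGFree ∧ S.Degrees ∧ S.Relations

/-- `S` is `r`-perfect: the reducible summand is concentrated in even degrees
(which forces `r = 0` and `δ₁ ∘ v^i ∘ δ₂ = 0` for all `i ≥ 0`). -/
def RPerfect (S : SCData R) : Prop :=
  (∀ j : ℤ, Odd j → S.Red.grading j = ⊥) ∧ S.r = 0 ∧
    ∀ i : ℕ, S.δ₁ ∘ₗ lpow S.v i ∘ₗ S.δ₂ = 0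

/-- The total graded module `C~ = C ⊕ C[-1] ⊕ 𝖱`. -/
def Tot (S : SCData R) : GradedMod R where
  carrier := S.Irr.carrier × S.Irr.carrier × S.Red.carrier
  grading j := (S.Irr.grading j).prod ((S.Irr.grading (j - 1)).prod (S.Red.grading j))

/-- The total differential `d~(c, c', ρ) = (d c, v c − d c' + δ₂ ρ, δ₁ c + r ρ)`. -/
def totalDiff (S : SCData R) : S.Tot.carrier →ₗ[R] S.Tot.carrier :=
  tri (S.d ∘ₗ pj₁) (S.v ∘ₗ pj₁ - S.d ∘ₗ pj₂ + S.δ₂ ∘ₗ pj₃) (S.δ₁ ∘ₗ pj₁ + S.r ∘ₗ pj₃)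

/-- The map `χ(c, c', ρ) = (0, c, 0)`. -/
def totalChi (S : SCData R) : S.Tot.carrier →ₗ[R] S.Tot.carrier :=
  tri 0 pj₁ 0

/-- The suspension `ΣC~`: `C_Σ = C[-2] ⊕ 𝖱[-1]`, `𝖱_Σ = 𝖱`, with the differential of
Definition 2.9 of the paper. -/
def susp (S : SCData R) : SCData R where
  Irr := { carrier := S.Irr.carrier × S.Red.carrier
           grading := fun j => (S.Irr.grading (j - 2)).prod (S.Red.grading (j - 1)) }
  Red := S.Red
  d := LinearMap.prod
      (S.d ∘ₗ LinearMap.fst R S.Irr.carrier S.Red.carrier -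
        S.δ₂ ∘ₗ LinearMap.snd R S.Irr.carrier S.Red.carrier)
      (-(S.r ∘ₗ LinearMap.snd R S.Irr.carrier S.Red.carrier))
  v := LinearMap.prod (S.v ∘ₗ LinearMap.fst R S.Irr.carrier S.Red.carrier)
      (S.δ₁ ∘ₗ LinearMap.fst R S.Irr.carrier S.Red.carrier)
  δ₁ := LinearMap.snd R S.Irr.carrier S.Red.carrier
  δ₂ := LinearMap.prod (S.v ∘ₗ S.δ₂) (S.δ₁ ∘ₗ S.δ₂)
  r := S.r

/-- The negative suspension `Σ⁻¹C~`: `C_{Σ⁻¹} = C[2] ⊕ 𝖱[2]`, `𝖱_{Σ⁻¹} = 𝖱`. -/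
def negSusp (S : SCData R) : SCData R where
  Irr := { carrier := S.Irr.carrier × S.Red.carrier
           grading := fun j => (S.Irr.grading (j + 2)).prod (S.Red.grading (j + 2)) }
  Red := S.Red
  d := LinearMap.prod (S.d ∘ₗ LinearMap.fst R S.Irr.carrier S.Red.carrier)
      (S.δ₁ ∘ₗ LinearMap.fst R S.Irr.carrier S.Red.carrier +
        S.r ∘ₗ LinearMap.snd R S.Irr.carrier S.Red.carrier)
  v := LinearMap.prod (S.v ∘ₗ LinearMap.fst R S.Irr.carrier S.Red.carrier +
        S.δ₂ ∘ₗ LinearMap.snd R S.Irr.carrier S.Red.carrier) 0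
  δ₁ := S.δ₁ ∘ₗ S.v ∘ₗ LinearMap.fst R S.Irr.carrier S.Red.carrier +
        S.δ₁ ∘ₗ S.δ₂ ∘ₗ LinearMap.snd R S.Irr.carrier S.Red.carrier
  δ₂ := LinearMap.prod 0 LinearMap.id
  r := S.r

/-- `Σ^n`, the `n`-fold (negative) suspension. -/
def suspPow (S : SCData R) : ℤ → SCData R
  | Int.ofNat n => (fun X : SCData R => X.susp)^[n] S
  | Int.negSucc n => (fun X : SCData R => X.negSusp)^[n + 1] S

/-- The shifted `S`-complex `C~[n]`: gradings shifted, same differential and `χ`-map. -/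
def shiftSC (S : SCData R) (n : ℤ) : SCData R where
  Irr := S.Irr.shift n
  Red := S.Red.shift n
  d := S.d
  v := S.v
  δ₁ := S.δ₁
  δ₂ := S.δ₂
  r := S.r

end SCData

/-- A map of `S`-complexes in block form `[[λ, 0, 0], [μ, λ, Δ₂], [Δ₁, 0, ρ]]`
(equivalently, a `χ`-equivariant map `C~ → C~'`); used both for morphisms and
(with appropriate signs in the total interpretation) for homotopies. -/
structure SMap {R : Type u} [CommRing R] (S T : SCData R) : Type u where
  lam : S.Irr.carrier →ₗ[R] T.Irr.carrier
  mu : S.Irr.carrier →ₗ[R] T.Irr.carrier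
  del1 : S.Irr.carrier →ₗ[R] T.Red.carrier
  del2 : S.Red.carrier →ₗ[R] T.Irr.carrier
  rho : S.Red.carrier →ₗ[R] T.Red.carrier

namespace SMap

variable {S T U : SCData R}

/-- The component relations equivalent to `d~' λ~ = λ~ d~`. -/
def IsMor (f : SMap S T) : Prop :=
  T.d ∘ₗ f.lam - f.lam ∘ₗ S.d = 0 ∧
  f.del1 ∘ₗ S.d + f.rho ∘ₗ S.δ₁ - T.δ₁ ∘ₗ f.lam - T.r ∘ₗ f.del1 = 0 ∧
  T.d ∘ₗ f.del2 - T.δ₂ ∘ₗ f.rho + f.lam ∘ₗ S.δ₂ + f.del2 ∘ₗ S.r = 0 ∧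
  f.mu ∘ₗ S.d + T.d ∘ₗ f.mu + f.lam ∘ₗ S.v - T.v ∘ₗ f.lam + f.del2 ∘ₗ S.δ₁ - T.δ₂ ∘ₗ f.del1 = 0 ∧
  f.rho ∘ₗ S.r - T.r ∘ₗ f.rho = 0

/-- The components have the degrees of a degree `k` map of `S`-complexes. -/
def DegreesAt (f : SMap S T) (k : ℤ) : Prop :=
  S.Irr.IsDeg T.Irr k f.lam ∧ S.Irr.IsDeg T.Irr (k - 1) f.mu ∧
  S.Irr.IsDeg T.Red k f.del1 ∧ S.Red.IsDeg T.Irr (k - 1) f.del2 ∧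
  S.Red.IsDeg T.Red k f.rho

/-- Composition of morphisms of `S`-complexes, componentwise. -/
def comp (g : SMap T U) (f : SMap S T) : SMap S U where
  lam := g.lam ∘ₗ f.lam
  mu := g.lam ∘ₗ f.mu + g.mu ∘ₗ f.lam + g.del2 ∘ₗ f.del1
  del1 := g.del1 ∘ₗ f.lam + g.rho ∘ₗ f.del1
  del2 := g.lam ∘ₗ f.del2 + g.del2 ∘ₗ f.rho
  rho := g.rho ∘ₗ f.rho

/-- `K` is an `S`-chain homotopy from `f` to `g`, i.e. `d~' K~ + K~ d~ = λ~ - λ~'` where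
`K~ = [[K, 0, 0], [L, -K, M₂], [M₁, 0, J]]`, in component form. -/
def IsHtpyFrom (K f g : SMap S T) : Prop :=
  T.d ∘ₗ K.lam + K.lam ∘ₗ S.d - f.lam + g.lam = 0 ∧
  T.δ₁ ∘ₗ K.lam + T.r ∘ₗ K.del1 + K.del1 ∘ₗ S.d + K.rho ∘ₗ S.δ₁ - f.del1 + g.del1 = 0 ∧
  -(T.d ∘ₗ K.del2) + T.δ₂ ∘ₗ K.rho - K.lam ∘ₗ S.δ₂ + K.del2 ∘ₗ S.r - f.del2 + g.del2 = 0 ∧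
  T.v ∘ₗ K.lam - T.d ∘ₗ K.mu + T.δ₂ ∘ₗ K.del1 + K.mu ∘ₗ S.d - K.lam ∘ₗ S.v + K.del2 ∘ₗ S.δ₁
    - f.mu + g.mu = 0 ∧
  T.r ∘ₗ K.rho + K.rho ∘ₗ S.r - f.rho + g.rho = 0

end SMap

/-- The identity morphism. -/
def idMap (S : SCData R) : SMap S S where
  lam := LinearMap.id
  mu := 0
  del1 := 0
  del2 := 0
  rho := LinearMap.id

/-- The total map `C~ → C~'` of a morphism in block form. -/
def morTotal {S T : SCData R} (f : SMap S T) : S.Tot.carrier →ₗ[R] T.Tot.carrier :=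
  tri (f.lam ∘ₗ pj₁) (f.mu ∘ₗ pj₁ + f.lam ∘ₗ pj₂ + f.del2 ∘ₗ pj₃) (f.del1 ∘ₗ pj₁ + f.rho ∘ₗ pj₃)

/-- The total map `C~ → C~'` of a homotopy in block form. -/
def htpTotal {S T : SCData R} (K : SMap S T) : S.Tot.carrier →ₗ[R] T.Tot.carrier :=
  tri (K.lam ∘ₗ pj₁) (K.mu ∘ₗ pj₁ - K.lam ∘ₗ pj₂ + K.del2 ∘ₗ pj₃) (K.del1 ∘ₗ pj₁ + K.rho ∘ₗ pj₃)

/-- `S`-chain homotopy equivalence of `S`-complexes. -/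
def SHomotopyEquiv (S T : SCData R) : Prop :=
  ∃ (f : SMap S T) (g : SMap T S) (H₁ : SMap S S) (H₂ : SMap T T),
    f.IsMor ∧ f.DegreesAt 0 ∧ g.IsMor ∧ g.DegreesAt 0 ∧
    H₁.DegreesAt 1 ∧ SMap.IsHtpyFrom H₁ (g.comp f) (idMap S) ∧
    H₂.DegreesAt 1 ∧ SMap.IsHtpyFrom H₂ (f.comp g) (idMap T)

/-- Isomorphism of `S`-complexes: a (degree `0`) morphism with a two-sided inverse morphism. -/
def SIso (S T : SCData R) : Prop :=
  ∃ (f : SMap S T) (g : SMap T S), f.IsMor ∧ f.DegreesAt 0 ∧ g.IsMor ∧ g.DegreesAt 0 ∧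
    g.comp f = idMap S ∧ f.comp g = idMap T

/-- The suspension `Σλ~` of a morphism `λ~`, in block form. -/
def suspMap {S T : SCData R} (f : SMap S T) : SMap S.susp T.susp where
  lam := LinearMap.prod
      (f.lam ∘ₗ LinearMap.fst R S.Irr.carrier S.Red.carrier +
        f.del2 ∘ₗ LinearMap.snd R S.Irr.carrier S.Red.carrier)
      (f.rho ∘ₗ LinearMap.snd R S.Irr.carrier S.Red.carrier)
  mu := LinearMap.prod (f.mu ∘ₗ LinearMap.fst R S.Irr.carrier S.Red.carrier)
      (f.del1 ∘ₗ LinearMap.fst R S.Irr.carrier S.Red.carrier)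
  del1 := 0
  del2 := LinearMap.prod (f.mu ∘ₗ S.δ₂ + T.v ∘ₗ f.del2) (f.del1 ∘ₗ S.δ₂ + T.δ₁ ∘ₗ f.del2)
  rho := f.rho

/-- The suspension `ΣK~` of a homotopy `K~`, in block form. -/
def suspHtpy {S T : SCData R} (K : SMap S T) : SMap S.susp T.susp where
  lam := LinearMap.prod
      (K.lam ∘ₗ LinearMap.fst R S.Irr.carrier S.Red.carrier -
        K.del2 ∘ₗ LinearMap.snd R S.Irr.carrier S.Red.carrier)
      (-(K.rho ∘ₗ LinearMap.snd R S.Irr.carrier S.Red.carrier))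
  mu := LinearMap.prod (K.mu ∘ₗ LinearMap.fst R S.Irr.carrier S.Red.carrier)
      (K.del1 ∘ₗ LinearMap.fst R S.Irr.carrier S.Red.carrier)
  del1 := 0
  del2 := LinearMap.prod (T.v ∘ₗ K.del2 + K.mu ∘ₗ S.δ₂) (T.δ₁ ∘ₗ K.del2 + K.del1 ∘ₗ S.δ₂)
  rho := K.rho

/-- The sequence `τ_0 = ρ`, `τ_{i+1} = δ₁'v'^iΔ₂ + Δ₁v^iδ₂ + Σ_{j<i} δ₁'v'^j μ v^{i−1−j} δ₂`
attached to an (even degree) morphism between `r`-perfect `S`-complexes. -/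
def tauSMap {S T : SCData R} (f : SMap S T) : ℕ → (S.Red.carrier →ₗ[R] T.Red.carrier)
  | 0 => f.rho
  | i + 1 =>
      T.δ₁ ∘ₗ lpow T.v i ∘ₗ f.del2 + f.del1 ∘ₗ lpow S.v i ∘ₗ S.δ₂ +
        ∑ j ∈ Finset.range i, T.δ₁ ∘ₗ lpow T.v j ∘ₗ f.mu ∘ₗ lpow S.v (i - 1 - j) ∘ₗ S.δ₂

/-- Height `n` (for `n ≥ 0`): `τ_j = 0` for `0 ≤ j < n`. -/
def SMap.HasHeight {S T : SCData R} (f : SMap S T) (n : ℕ) : Prop :=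
  ∀ j : ℕ, j < n → tauSMap f j = 0

/-- Strong height `n`: height `n` and `τ_n` an isomorphism. -/
def SMap.StrongHeight {S T : SCData R} (f : SMap S T) (n : ℕ) : Prop :=
  f.HasHeight n ∧ Function.Bijective ⇑(tauSMap f n)

/-- The explicit model of the `n`-fold suspension `Σ^n C~` of an `r`-perfect `S`-complex:
`C_{Σ^n} = C[-2n] ⊕ ⊕_{i=0}^{n-1} 𝖱[-2i-1]` (the `m`-th factor of `Fin n → 𝖱` being
`𝖱[-2(n-1-m)-1]`), `𝖱_{Σ^n} = 𝖱`, with the components of the differential as in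
Subsection 2.4 of the paper. -/
def SCData.suspN (S : SCData R) (n : ℕ) : SCData R where
  Irr := { carrier := S.Irr.carrier × (Fin n → S.Red.carrier)
           grading := fun j => (S.Irr.grading (j - 2 * (n : ℤ))).prod
             (Submodule.pi Set.univ fun m : Fin n =>
               S.Red.grading (j - 2 * (((n - 1 - (m : ℕ) : ℕ)) : ℤ) - 1)) }
  Red := S.Red
  d := LinearMap.prod
      (S.d ∘ₗ LinearMap.fst R S.Irr.carrier (Fin n → S.Red.carrier) -
        ∑ m : Fin n, lpow S.v (m : ℕ) ∘ₗ S.δ₂ ∘ₗ LinearMap.proj m ∘ₗ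
          LinearMap.snd R S.Irr.carrier (Fin n → S.Red.carrier)) 0
  v := LinearMap.prod (S.v ∘ₗ LinearMap.fst R S.Irr.carrier (Fin n → S.Red.carrier))
      (LinearMap.pi fun m : Fin n =>
        if (m : ℕ) = 0 then S.δ₁ ∘ₗ LinearMap.fst R S.Irr.carrier (Fin n → S.Red.carrier)
        else LinearMap.proj (⟨(m : ℕ) - 1, lt_of_le_of_lt (Nat.sub_le _ _) m.isLt⟩ : Fin n) ∘ₗ
          LinearMap.snd R S.Irr.carrier (Fin n → S.Red.carrier))
  δ₁ := if h : 0 < n then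
      LinearMap.proj (⟨n - 1, Nat.sub_lt h Nat.one_pos⟩ : Fin n) ∘ₗ
        LinearMap.snd R S.Irr.carrier (Fin n → S.Red.carrier)
    else 0
  δ₂ := LinearMap.prod (lpow S.v n ∘ₗ S.δ₂) 0
  r := 0

/-- The natural morphism `ι~_n : C~ → Σ^n C~`, with `λ`-component `c ↦ (c, 0, …, 0)` and
`Δ₂`-component `θ ↦ (0, θ, 0, …, 0)`. -/
def iotaN (S : SCData R) (n : ℕ) : SMap S (S.suspN n) where
  lam := LinearMap.prod LinearMap.id 0
  mu := 0
  del1 := 0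
  del2 := LinearMap.prod 0 (LinearMap.pi fun m : Fin n => if (m : ℕ) = 0 then LinearMap.id else 0)
  rho := 0

/-- The data of a generalized height morphism between `r`-perfect `S`-complexes:
the four maps `λ, μ, Δ₁, Δ₂` and the sequence `τ_i` for `i ∈ ℤ`. -/
structure HMor {R : Type u} [CommRing R] (S T : SCData R) : Type u where
  lam : S.Irr.carrier →ₗ[R] T.Irr.carrier
  mu : S.Irr.carrier →ₗ[R] T.Irr.carrier
  del1 : S.Irr.carrier →ₗ[R] T.Red.carrier
  del2 : S.Red.carrier →ₗ[R] T.Irr.carrier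
  tau : ℤ → (S.Red.carrier →ₗ[R] T.Red.carrier)

/-- `f` is a height `n` morphism of (even) degree `k` between `r`-perfect `S`-complexes. -/
def HMor.IsHeightMor {S T : SCData R} (f : HMor S T) (n : ℤ) (k : ℤ) : Prop :=
  Even k ∧
  S.Irr.IsDeg T.Irr k f.lam ∧ S.Irr.IsDeg T.Irr (k - 1) f.mu ∧
  S.Irr.IsDeg T.Red k f.del1 ∧ S.Red.IsDeg T.Irr (k - 1) f.del2 ∧
  (∀ i : ℤ, S.Red.IsDeg T.Red (k - 2 * i) (f.tau i)) ∧
  (∀ i : ℤ, i < n → f.tau i = 0) ∧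
  (∀ i : ℕ, f.tau ((i : ℤ) + 1) =
      T.δ₁ ∘ₗ lpow T.v i ∘ₗ f.del2 + f.del1 ∘ₗ lpow S.v i ∘ₗ S.δ₂ +
        ∑ j ∈ Finset.range i, T.δ₁ ∘ₗ lpow T.v j ∘ₗ f.mu ∘ₗ lpow S.v (i - 1 - j) ∘ₗ S.δ₂) ∧
  (T.d ∘ₗ f.lam - f.lam ∘ₗ S.d -
      ∑ᶠ i : ℕ, ∑ j ∈ Finset.range (i + 1),
        lpow T.v j ∘ₗ T.δ₂ ∘ₗ f.tau (-((i : ℤ) + 1)) ∘ₗ S.δ₁ ∘ₗ lpow S.v (i - j) = 0) ∧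
  (-(T.δ₁ ∘ₗ f.lam) + f.del1 ∘ₗ S.d + ∑ᶠ i : ℕ, f.tau (-(i : ℤ)) ∘ₗ S.δ₁ ∘ₗ lpow S.v i = 0) ∧
  (f.lam ∘ₗ S.δ₂ + T.d ∘ₗ f.del2 - ∑ᶠ i : ℕ, lpow T.v i ∘ₗ T.δ₂ ∘ₗ f.tau (-(i : ℤ)) = 0) ∧
  (f.mu ∘ₗ S.d + T.d ∘ₗ f.mu + f.lam ∘ₗ S.v - T.v ∘ₗ f.lam + f.del2 ∘ₗ S.δ₁ - T.δ₂ ∘ₗ f.del1 = 0)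

/-- Composition of generalized height morphisms (Definition 2.23 of the paper). -/
noncomputable def HMor.compH {S T U : SCData R} (g : HMor T U) (f : HMor S T) : HMor S U where
  lam := g.lam ∘ₗ f.lam
    + (∑ᶠ i : ℕ, ∑ j ∈ Finset.range (i + 1),
        lpow U.v j ∘ₗ U.δ₂ ∘ₗ g.tau (-((i : ℤ) + 1)) ∘ₗ f.del1 ∘ₗ lpow S.v (i - j))
    + (∑ᶠ i : ℕ, ∑ j ∈ Finset.range (i + 1),
        lpow U.v j ∘ₗ g.del2 ∘ₗ f.tau (-((i : ℤ) + 1)) ∘ₗ S.δ₁ ∘ₗ lpow S.v (i - j))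
    + (∑ᶠ i : ℕ, ∑ j ∈ Finset.range (i + 1), ∑ l ∈ Finset.range (i - j + 1),
        lpow U.v j ∘ₗ U.δ₂ ∘ₗ g.tau (-((i : ℤ) + 2)) ∘ₗ T.δ₁ ∘ₗ lpow T.v l ∘ₗ f.mu ∘ₗ
          lpow S.v (i - j - l))
    + (∑ᶠ i : ℕ, ∑ j ∈ Finset.range (i + 1), ∑ l ∈ Finset.range (i - j + 1),
        lpow U.v j ∘ₗ g.mu ∘ₗ lpow T.v l ∘ₗ T.δ₂ ∘ₗ f.tau (-((i : ℤ) + 2)) ∘ₗ S.δ₁ ∘ₗ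
          lpow S.v (i - j - l))
  mu := g.lam ∘ₗ f.mu + g.mu ∘ₗ f.lam + g.del2 ∘ₗ f.del1
  del1 := g.del1 ∘ₗ f.lam + (∑ᶠ i : ℕ, g.tau (-(i : ℤ)) ∘ₗ f.del1 ∘ₗ lpow S.v i)
    + (∑ᶠ i : ℕ, ∑ j ∈ Finset.range (i + 1),
        g.tau (-((i : ℤ) + 1)) ∘ₗ T.δ₁ ∘ₗ lpow T.v j ∘ₗ f.mu ∘ₗ lpow S.v (i - j))
  del2 := g.lam ∘ₗ f.del2 + (∑ᶠ i : ℕ, lpow U.v i ∘ₗ g.del2 ∘ₗ f.tau (-(i : ℤ)))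
    + (∑ᶠ i : ℕ, ∑ j ∈ Finset.range (i + 1),
        lpow U.v j ∘ₗ g.mu ∘ₗ lpow T.v (i - j) ∘ₗ T.δ₂ ∘ₗ f.tau (-((i : ℤ) + 1)))
  tau := fun i => ∑ᶠ l : ℤ, g.tau (i - l) ∘ₗ f.tau l

/-- The strong height `−n` morphism `κ~_n : Σ^n C~ → C~`. -/
def kappaN (T : SCData R) (n : ℕ) : HMor (T.suspN n) T where
  lam := LinearMap.fst R T.Irr.carrier (Fin n → T.Red.carrier)
  mu := 0
  del1 := 0
  del2 := 0
  tau := fun i => if i = -(n : ℤ) then LinearMap.id else 0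

/-- An (even degree) morphism of `S`-complexes, regarded as a generalized height morphism. -/
def SMap.toHMor {S T : SCData R} (f : SMap S T) : HMor S T where
  lam := f.lam
  mu := f.mu
  del1 := f.del1
  del2 := f.del2
  tau := fun i => if 0 ≤ i then tauSMap f i.toNat else 0

/-- The height `0` morphism `λ~' : C~ → Σ^n C~'` associated to a height `−n` morphism
(Proposition 2.25 of the paper). -/
def heightNegToSusp {S T : SCData R} (f : HMor S T) (n : ℕ) : SMap S (T.suspN n) where
  lam := LinearMap.prod f.lam
    (LinearMap.pi fun m : Fin n =>
      ∑ i ∈ Finset.Icc ((m : ℕ) + 1) n, f.tau (-(i : ℤ)) ∘ₗ S.δ₁ ∘ₗ lpow S.v (i - 1 - (m : ℕ)))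
  mu := LinearMap.prod f.mu (LinearMap.pi fun m : Fin n => if (m : ℕ) = 0 then f.del1 else 0)
  del1 := 0
  del2 := LinearMap.prod f.del2 (LinearMap.pi fun m : Fin n => f.tau (-((m : ℕ) : ℤ)))
  rho := f.tau (-(n : ℤ))

/-- The morphism `ι~₁ : C~ → ΣC~`. -/
def iotaOne (S : SCData R) : SMap S S.susp where
  lam := LinearMap.prod LinearMap.id 0
  mu := 0
  del1 := 0
  del2 := LinearMap.prod 0 LinearMap.id
  rho := 0

/-- The morphism `λ~'' : ΣC~' → C~''` associated to an odd degree morphism `λ~'` together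
with the map `ν' : 𝖱' → 𝖱''` (Subsection 2.6 of the paper). -/
def lambdaSecond {S T : SCData R} (f : SMap S T) (nu : S.Red.carrier →ₗ[R] T.Red.carrier) :
    SMap S.susp T where
  lam := f.lam ∘ₗ LinearMap.fst R S.Irr.carrier S.Red.carrier +
    f.del2 ∘ₗ LinearMap.snd R S.Irr.carrier S.Red.carrier
  mu := f.mu ∘ₗ LinearMap.fst R S.Irr.carrier S.Red.carrier
  del1 := f.del1 ∘ₗ LinearMap.fst R S.Irr.carrier S.Red.carrier +
    nu ∘ₗ LinearMap.snd R S.Irr.carrier S.Red.carrier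
  del2 := f.mu ∘ₗ S.δ₂ + T.v ∘ₗ f.del2 + T.δ₂ ∘ₗ nu
  rho := 0

/-- The morphism `λ~₁ : C~ → ΣC~'` associated to height `−1` morphism data
`(λ, μ, Δ₁, Δ₂, τ₀, τ₋₁)`, in block form
`[[λ, 0, 0], [τ₋₁δ₁, 0, 0], [μ, λ, Δ₂], [Δ₁, τ₋₁δ₁, τ₀], [0, 0, τ₋₁]]`. -/
def hNegOneSusp {S T : SCData R} (lam0 mu0 : S.Irr.carrier →ₗ[R] T.Irr.carrier)
    (del10 : S.Irr.carrier →ₗ[R] T.Red.carrier) (del20 : S.Red.carrier →ₗ[R] T.Irr.carrier)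
    (tau0 taum1 : S.Red.carrier →ₗ[R] T.Red.carrier) : SMap S T.susp where
  lam := LinearMap.prod lam0 (taum1 ∘ₗ S.δ₁)
  mu := LinearMap.prod mu0 del10
  del1 := 0
  del2 := LinearMap.prod del20 tau0
  rho := taum1

/-- The mapping cone of a degree `k` morphism `λ~ : C~ → C~'`, as an `S`-complex;
its underlying graded module is `C~[-1-k] ⊕ C~'`. -/
def coneSC {S T : SCData R} (f : SMap S T) (k : ℤ) : SCData R where
  Irr := { carrier := S.Irr.carrier × T.Irr.carrier
           grading := fun j => (S.Irr.grading (j - 1 - k)).prod (T.Irr.grading j) }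
  Red := { carrier := S.Red.carrier × T.Red.carrier
           grading := fun j => (S.Red.grading (j - 1 - k)).prod (T.Red.grading j) }
  d := LinearMap.prod (-(S.d ∘ₗ LinearMap.fst R S.Irr.carrier T.Irr.carrier))
      (f.lam ∘ₗ LinearMap.fst R S.Irr.carrier T.Irr.carrier +
        T.d ∘ₗ LinearMap.snd R S.Irr.carrier T.Irr.carrier)
  v := LinearMap.prod (S.v ∘ₗ LinearMap.fst R S.Irr.carrier T.Irr.carrier)
      (f.mu ∘ₗ LinearMap.fst R S.Irr.carrier T.Irr.carrier +
        T.v ∘ₗ LinearMap.snd R S.Irr.carrier T.Irr.carrier)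
  δ₁ := LinearMap.prod (-(S.δ₁ ∘ₗ LinearMap.fst R S.Irr.carrier T.Irr.carrier))
      (f.del1 ∘ₗ LinearMap.fst R S.Irr.carrier T.Irr.carrier +
        T.δ₁ ∘ₗ LinearMap.snd R S.Irr.carrier T.Irr.carrier)
  δ₂ := LinearMap.prod (S.δ₂ ∘ₗ LinearMap.fst R S.Red.carrier T.Red.carrier)
      (f.del2 ∘ₗ LinearMap.fst R S.Red.carrier T.Red.carrier +
        T.δ₂ ∘ₗ LinearMap.snd R S.Red.carrier T.Red.carrier)
  r := LinearMap.prod (-(S.r ∘ₗ LinearMap.fst R S.Red.carrier T.Red.carrier))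
      (f.rho ∘ₗ LinearMap.fst R S.Red.carrier T.Red.carrier +
        T.r ∘ₗ LinearMap.snd R S.Red.carrier T.Red.carrier)

/-- Direct sum of `S`-complexes. -/
def sumSC (S T : SCData R) : SCData R where
  Irr := S.Irr.prodGM T.Irr
  Red := S.Red.prodGM T.Red
  d := S.d.prodMap T.d
  v := S.v.prodMap T.v
  δ₁ := S.δ₁.prodMap T.δ₁
  δ₂ := S.δ₂.prodMap T.δ₂
  r := S.r.prodMap T.r

/-- The dual `S`-complex `C~†`, defined using sign operators on the dual graded modules:
`m†(f) = −ε(f) f ∘ m`, with the roles of `δ₁` and `δ₂` interchanged. -/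
def dualSC (S : SCData R)
    (eCd : Module.Dual R S.Irr.carrier →ₗ[R] Module.Dual R S.Irr.carrier)
    (eRd : Module.Dual R S.Red.carrier →ₗ[R] Module.Dual R S.Red.carrier) : SCData R where
  Irr := S.Irr.dualGM
  Red := S.Red.dualGM
  d := -(S.d.dualMap ∘ₗ eCd)
  v := -(S.v.dualMap ∘ₗ eCd)
  δ₁ := -(S.δ₂.dualMap ∘ₗ eCd)
  δ₂ := -(S.δ₁.dualMap ∘ₗ eRd)
  r := -(S.r.dualMap ∘ₗ eRd)

/-- The rank-one graded module `R`, concentrated in degree `n`. -/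
def unitGM (R : Type u) [CommRing R] (n : ℤ) : GradedMod R where
  carrier := R
  grading j := if j = n then ⊤ else ⊥

/-- The `S`-complex `O~(1)`: `C = R` in degree `1`, `𝖱 = R` in degree `0`, `δ₁ = id`. -/
def O1 (R : Type u) [CommRing R] : SCData R where
  Irr := unitGM R 1
  Red := unitGM R 0
  d := 0
  v := 0
  δ₁ := LinearMap.id
  δ₂ := 0
  r := 0

/-- The `S`-complex `O~(-1)`: `C = R` in degree `-2`, `𝖱 = R` in degree `0`, `δ₂ = id`. -/
def Om1 (R : Type u) [CommRing R] : SCData R where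
  Irr := unitGM R (-2)
  Red := unitGM R 0
  d := 0
  v := 0
  δ₁ := 0
  δ₂ := LinearMap.id
  r := 0

/-- The `S`-complex `O~(0)`: `C = 0`, `𝖱 = R` in degree `0`, zero differential. -/
def O0 (R : Type u) [CommRing R] : SCData R where
  Irr := { carrier := ↥(⊥ : Submodule R R), grading := fun _ => ⊥ }
  Red := unitGM R 0
  d := 0
  v := 0
  δ₁ := 0
  δ₂ := 0
  r := 0

/-- The `S`-complex representation of the tensor product `C~ ⊗ C~'` of `S`-complexes
(Subsection 2.2 of the paper), where `eC`, `eR` are the sign operators of the first factor: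
`C^⊗ = (C⊗C') ⊕ (C⊗C')[-1] ⊕ (C⊗𝖱') ⊕ (𝖱⊗C')` and `𝖱^⊗ = 𝖱⊗𝖱'`. -/
noncomputable def tensorRep (S T : SCData R)
    (eC : S.Irr.carrier →ₗ[R] S.Irr.carrier) (eR : S.Red.carrier →ₗ[R] S.Red.carrier) :
    SCData R where
  Irr := (S.Irr.tensorGM T.Irr).prodGM (((S.Irr.tensorGM T.Irr).shift (-1)).prodGM
      ((S.Irr.tensorGM T.Red).prodGM (S.Red.tensorGM T.Irr)))
  Red := S.Red.tensorGM T.Red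
  d := quad
      (TensorProduct.map S.d LinearMap.id ∘ₗ qj₁ + TensorProduct.map eC T.d ∘ₗ qj₁)
      (TensorProduct.map (-(eC ∘ₗ S.v)) LinearMap.id ∘ₗ qj₁ + TensorProduct.map eC T.v ∘ₗ qj₁
        + TensorProduct.map S.d LinearMap.id ∘ₗ qj₂ - TensorProduct.map eC T.d ∘ₗ qj₂
        + TensorProduct.map eC T.δ₂ ∘ₗ qj₃
        + TensorProduct.map (-(eC ∘ₗ S.δ₂)) LinearMap.id ∘ₗ qj₄)
      (TensorProduct.map eC T.δ₁ ∘ₗ qj₁ + TensorProduct.map S.d LinearMap.id ∘ₗ qj₃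
        + TensorProduct.map eC T.r ∘ₗ qj₃)
      (TensorProduct.map S.δ₁ LinearMap.id ∘ₗ qj₁ + TensorProduct.map eR T.d ∘ₗ qj₄
        + TensorProduct.map S.r LinearMap.id ∘ₗ qj₄)
  v := quad
      (TensorProduct.map S.v LinearMap.id ∘ₗ qj₁ + TensorProduct.map S.δ₂ LinearMap.id ∘ₗ qj₄)
      (TensorProduct.map S.v LinearMap.id ∘ₗ qj₂)
      (TensorProduct.map S.v LinearMap.id ∘ₗ qj₃)
      (TensorProduct.map (eR ∘ₗ S.δ₁) LinearMap.id ∘ₗ qj₂ + TensorProduct.map LinearMap.id T.v ∘ₗ qj₄)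
  δ₁ := TensorProduct.map S.δ₁ LinearMap.id ∘ₗ qj₃ + TensorProduct.map eR T.δ₁ ∘ₗ qj₄
  δ₂ := quad 0 0 (TensorProduct.map S.δ₂ LinearMap.id) (TensorProduct.map LinearMap.id T.δ₂)
  r := TensorProduct.map S.r LinearMap.id + TensorProduct.map eR T.r

/-- Homology of an endomorphism (thought of as a differential): `ker D / im D`. -/
abbrev homologyOf {M : Type u} [AddCommGroup M] [Module R M] (D : M →ₗ[R] M) : Type u :=
  ↥(LinearMap.ker D) ⧸
    Submodule.comap (LinearMap.ker D).subtype (LinearMap.range D)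

/-- The map induced on homology by a chain map. -/
def inducedMap {M N : Type u} [AddCommGroup M] [Module R M] [AddCommGroup N] [Module R N]
    (DM : M →ₗ[R] M) (DN : N →ₗ[R] N) (f : M →ₗ[R] N) (h : DN ∘ₗ f = f ∘ₗ DM) :
    homologyOf DM →ₗ[R] homologyOf DN :=
  Submodule.mapQ _ _
    (f.restrict (p := LinearMap.ker DM) (q := LinearMap.ker DN) (fun x hx => by
      have h1 : DN (f x) = f (DM x) := by
        have h2 := LinearMap.congr_fun h x
        simpa using h2
      have hx0 : DM x = 0 := LinearMap.mem_ker.mp hx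
      simp [LinearMap.mem_ker, h1, hx0]))
    (by
      intro x hx
      simp only [Submodule.mem_comap] at hx ⊢
      obtain ⟨y, hy⟩ := hx
      refine ⟨f y, ?_⟩
      have h1 : DN (f y) = f (DM y) := by
        have h2 := LinearMap.congr_fun h y
        simpa using h2
      simp only [Submodule.coe_subtype] at hy ⊢
      rw [LinearMap.restrict_apply]
      rw [h1, hy])

/-- The degree `j` homology of a graded module with a (degree `-1`) differential. -/
abbrev gradedHomology (M : GradedMod R) (D : M.carrier →ₗ[R] M.carrier) (j : ℤ) : Type u :=
  ↥(M.grading j ⊓ LinearMap.ker D) ⧸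
    Submodule.comap (M.grading j ⊓ LinearMap.ker D).subtype ((M.grading (j + 1)).map D)

/-- The Euler characteristic `Σ_j (-1)^j rk_R M_j` of a graded module. -/
noncomputable def eulerChar (M : GradedMod R) : ℤ :=
  ∑ᶠ j : ℤ, (if Even j then (1 : ℤ) else -1) * (Module.finrank R ↥(M.grading j) : ℤ)

/-- The small equivariant complex `Ĉ = C[-1] ⊕ 𝖱[x]`, with `𝖱[x]` modelled as `ℕ →₀ 𝖱`. -/
abbrev hatC (S : SCData R) : Type u := S.Irr.carrier × (ℕ →₀ S.Red.carrier)

/-- The differential `𝔡̂(α, θxⁱ) = (dα − vⁱδ₂θ, 0)`. -/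
noncomputable def hatD (S : SCData R) : hatC S →ₗ[R] hatC S :=
  LinearMap.prod
    (S.d ∘ₗ LinearMap.fst R S.Irr.carrier (ℕ →₀ S.Red.carrier) -
      (Finsupp.lsum ℕ fun i : ℕ => lpow S.v i ∘ₗ S.δ₂) ∘ₗ
        LinearMap.snd R S.Irr.carrier (ℕ →₀ S.Red.carrier))
    0

/-- The `x`-action `x·(α, θxⁱ) = (vα, δ₁α + θx^{i+1})` on `Ĉ`. -/
noncomputable def hatX (S : SCData R) : hatC S →ₗ[R] hatC S :=
  LinearMap.prod (S.v ∘ₗ LinearMap.fst R S.Irr.carrier (ℕ →₀ S.Red.carrier))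
    (Finsupp.lsingle 0 ∘ₗ S.δ₁ ∘ₗ LinearMap.fst R S.Irr.carrier (ℕ →₀ S.Red.carrier) +
      Finsupp.lmapDomain S.Red.carrier R (fun i => i + 1) ∘ₗ
        LinearMap.snd R S.Irr.carrier (ℕ →₀ S.Red.carrier))

/-- The small equivariant complex `Č = C ⊕ 𝖱[[x⁻¹,x]/𝖱[x]`, the tail modelled as `ℕ → 𝖱`
(the `m`-th coordinate is the coefficient of `x^{-m-1}`). -/
abbrev checkC (S : SCData R) : Type u := S.Irr.carrier × (ℕ → S.Red.carrier)

/-- The differential `𝔡̌(α, θxⁱ) = (dα, Σ_{j≤-1} δ₁v^{−j−1}(α)xʲ)`. -/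
noncomputable def checkD (S : SCData R) : checkC S →ₗ[R] checkC S :=
  LinearMap.prod (S.d ∘ₗ LinearMap.fst R S.Irr.carrier (ℕ → S.Red.carrier))
    (LinearMap.pi fun m : ℕ =>
      S.δ₁ ∘ₗ lpow S.v m ∘ₗ LinearMap.fst R S.Irr.carrier (ℕ → S.Red.carrier))

/-- The `x`-action on `Č`. -/
noncomputable def checkX (S : SCData R) : checkC S →ₗ[R] checkC S :=
  LinearMap.prod
    (S.v ∘ₗ LinearMap.fst R S.Irr.carrier (ℕ → S.Red.carrier) +
      S.δ₂ ∘ₗ LinearMap.proj 0 ∘ₗ LinearMap.snd R S.Irr.carrier (ℕ → S.Red.carrier))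
    (LinearMap.pi fun m : ℕ =>
      LinearMap.proj (m + 1) ∘ₗ LinearMap.snd R S.Irr.carrier (ℕ → S.Red.carrier))

/-- The module `𝖱[[x⁻¹,x]` of Laurent series with finitely many positive powers, modelled
as (polynomial part, tail): `(ℕ →₀ 𝖱) × (ℕ → 𝖱)`. -/
abbrev barC (S : SCData R) : Type u := (ℕ →₀ S.Red.carrier) × (ℕ → S.Red.carrier)

/-- Multiplication by `x` on `𝖱[[x⁻¹,x]`. -/
noncomputable def barX (S : SCData R) : barC S →ₗ[R] barC S :=
  LinearMap.prod
    (Finsupp.lsingle 0 ∘ₗ LinearMap.proj 0 ∘ₗ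
        LinearMap.snd R (ℕ →₀ S.Red.carrier) (ℕ → S.Red.carrier) +
      Finsupp.lmapDomain S.Red.carrier R (fun i => i + 1) ∘ₗ
        LinearMap.fst R (ℕ →₀ S.Red.carrier) (ℕ → S.Red.carrier))
    (LinearMap.pi fun m : ℕ =>
      LinearMap.proj (m + 1) ∘ₗ LinearMap.snd R (ℕ →₀ S.Red.carrier) (ℕ → S.Red.carrier))

/-- The chain map `𝔦 : Ĉ → 𝖱[[x⁻¹,x]`, `(α, θ) ↦ Σ_{i≤-1} δ₁v^{−i−1}(α)xⁱ + θ`. -/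
noncomputable def mapI (S : SCData R) : hatC S →ₗ[R] barC S :=
  LinearMap.prod (LinearMap.snd R S.Irr.carrier (ℕ →₀ S.Red.carrier))
    (LinearMap.pi fun m : ℕ =>
      S.δ₁ ∘ₗ lpow S.v m ∘ₗ LinearMap.fst R S.Irr.carrier (ℕ →₀ S.Red.carrier))

/-- The chain map `𝔧 : Č → Ĉ`, `(α, ·) ↦ (−α, 0)`. -/
noncomputable def mapJ (S : SCData R) : checkC S →ₗ[R] hatC S :=
  LinearMap.prod (-(LinearMap.fst R S.Irr.carrier (ℕ → S.Red.carrier))) 0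

/-- The chain map `𝔭 : 𝖱[[x⁻¹,x] → Č`, `Σθᵢxⁱ ↦ (Σ_{i≥0} vⁱδ₂θᵢ, Σ_{i≤-1} θᵢxⁱ)`. -/
noncomputable def mapP (S : SCData R) : barC S →ₗ[R] checkC S :=
  LinearMap.prod
    ((Finsupp.lsum ℕ fun i : ℕ => lpow S.v i ∘ₗ S.δ₂) ∘ₗ
      LinearMap.fst R (ℕ →₀ S.Red.carrier) (ℕ → S.Red.carrier))
    (LinearMap.snd R (ℕ →₀ S.Red.carrier) (ℕ → S.Red.carrier))

/-- The coefficient of `xᵉ`, as a linear map `𝖱[[x⁻¹,x] → 𝖱`. -/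
noncomputable def coeffLM (S : SCData R) (e : ℤ) : barC S →ₗ[R] S.Red.carrier :=
  if 0 ≤ e then
    Finsupp.lapply e.toNat ∘ₗ LinearMap.fst R (ℕ →₀ S.Red.carrier) (ℕ → S.Red.carrier)
  else
    LinearMap.proj (-e - 1).toNat ∘ₗ LinearMap.snd R (ℕ →₀ S.Red.carrier) (ℕ → S.Red.carrier)

/-- `𝔍(C~) ⊆ 𝖱[[x⁻¹,x]`, the image of `i⋆ : Ĥ → 𝖱[[x⁻¹,x]` (equal to `𝔦(ker 𝔡̂)`). -/
noncomputable def Jmod (S : SCData R) : Submodule R (barC S) :=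
  (LinearMap.ker (hatD S)).map (mapI S)

/-- `J_i(C~) = { a₀ ∈ 𝖱 | ∃ a₀x^{-i} + a₋₁x^{-i-1} + ⋯ ∈ 𝔍(C~) }`. -/
noncomputable def Jset (S : SCData R) (i : ℤ) : Submodule R S.Red.carrier :=
  ((Jmod S) ⊓ ⨅ (e : ℤ) (_ : -i < e), LinearMap.ker (coeffLM S e)).map (coeffLM S (-i))

/-- The function `d_{C~}(i) = rk_R J_i(C~)`. -/
noncomputable def dFun (S : SCData R) (i : ℤ) : ℕ := Module.finrank R ↥(Jset S i)

namespace GradedMod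

theorem IsDeg.mem {M N : GradedMod R} {k : ℤ} {f : M.carrier →ₗ[R] N.carrier}
    (hf : M.IsDeg N k f) {i j : ℤ} (hij : j = i + k) {x : M.carrier} (hx : x ∈ M.grading i) :
    f x ∈ N.grading j :=
  hij ▸ hf i (Submodule.mem_map_of_mem hx)

theorem IsDeg.zero (M N : GradedMod R) (k : ℤ) : M.IsDeg N k 0 := by
  rintro i _ ⟨x, -, rfl⟩
  exact zero_mem _

theorem IsFGFree.linearMap_ext {M : GradedMod R} (hM : M.IsFGFree) {P : Type*} [AddCommGroup P]
    [Module R P] {f g : M.carrier →ₗ[R] P} (h : ∀ i, ∀ x ∈ M.grading i, f x = g x) : f = g := by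
  have htop : (⊤ : Submodule R M.carrier) ≤ LinearMap.eqLocus f g := by
    rw [← hM.1.submodule_iSup_eq_top]
    exact iSup_le fun i x hx => h i x hx
  exact LinearMap.ext fun x => htop Submodule.mem_top

theorem IsSign.mem {M : GradedMod R} {e : M.carrier →ₗ[R] M.carrier} (he : M.IsSign e) {i : ℤ}
    {x : M.carrier} (hx : x ∈ M.grading i) : e x ∈ M.grading i := by
  rw [he i x hx]
  split_ifs
  exacts [hx, neg_mem hx]

theorem IsSign.apply_apply {M : GradedMod R} (hM : M.IsFGFree) {e : M.carrier →ₗ[R] M.carrier}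
    (he : M.IsSign e) (x : M.carrier) : e (e x) = x := by
  refine LinearMap.congr_fun (hM.linearMap_ext (f := e ∘ₗ e) (g := LinearMap.id) ?_) x
  intro i x hx
  by_cases hi : Even i <;> simp [he i x hx, hi]

theorem IsSign.apply_of_even {M N : GradedMod R} (hM : M.IsFGFree)
    {e : M.carrier →ₗ[R] M.carrier} {e' : N.carrier →ₗ[R] N.carrier} (he : M.IsSign e)
    (he' : N.IsSign e') {k : ℤ} (hk : Even k) {f : M.carrier →ₗ[R] N.carrier}
    (hf : M.IsDeg N k f) (x : M.carrier) : f (e x) = e' (f x) := by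
  refine LinearMap.congr_fun (hM.linearMap_ext (f := f ∘ₗ e) (g := e' ∘ₗ f) ?_) x
  intro i x hx
  by_cases hi : Even i <;>
    simp [he i x hx, he' _ _ (hf.mem rfl hx), hi, hk, Int.even_add]

theorem IsSign.apply_of_odd {M N : GradedMod R} (hM : M.IsFGFree)
    {e : M.carrier →ₗ[R] M.carrier} {e' : N.carrier →ₗ[R] N.carrier} (he : M.IsSign e)
    (he' : N.IsSign e') {k : ℤ} (hk : ¬ Even k) {f : M.carrier →ₗ[R] N.carrier}
    (hf : M.IsDeg N k f) (x : M.carrier) : f (e x) = -e' (f x) := by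
  refine LinearMap.congr_fun (hM.linearMap_ext (f := f ∘ₗ e) (g := -(e' ∘ₗ f)) ?_) x
  intro i x hx
  by_cases hi : Even i <;>
    simp [he i x hx, he' _ _ (hf.mem rfl hx), hi, hk, Int.even_add]

/-- The identification `M ≃ M ⊗ R[n]` of the underlying modules. -/
noncomputable def tensorUnit (M : GradedMod R) (n : ℤ) :
    M.carrier ≃ₗ[R] TensorProduct R M.carrier (unitGM R n).carrier :=
  (TensorProduct.rid R M.carrier).symm

theorem tensorUnit_mem (M : GradedMod R) (n : ℤ) {j k : ℤ} (hk : k = j + n) {x : M.carrier}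
    (hx : x ∈ M.grading j) : M.tensorUnit n x ∈ (M.tensorGM (unitGM R n)).grading k := by
  refine Submodule.mem_iSup_of_mem j (Submodule.apply_mem_map₂ _ hx ?_)
  have htop : (unitGM R n).grading (k - j) = ⊤ := if_pos (by omega)
  rw [htop]
  exact Submodule.mem_top

theorem tensorUnit_symm_mem (M : GradedMod R) (n : ℤ) {j k : ℤ} (hk : k = j + n)
    {z : TensorProduct R M.carrier (unitGM R n).carrier}
    (hz : z ∈ (M.tensorGM (unitGM R n)).grading k) : (M.tensorUnit n).symm z ∈ M.grading j := by
  suffices h : (M.tensorGM (unitGM R n)).grading k ≤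
      (M.grading j).comap (M.tensorUnit n).symm.toLinearMap from h hz
  refine iSup_le fun i => Submodule.map₂_le.2 fun x hx y hy => ?_
  change (TensorProduct.rid R M.carrier) (x ⊗ₜ[R] (show R from y)) ∈ M.grading j
  rw [TensorProduct.rid_tmul]
  by_cases hi : k - i = n
  · obtain rfl : i = j := by omega
    exact Submodule.smul_mem _ _ hx
  · have hbot : (unitGM R n).grading (k - i) = ⊥ := if_neg hi
    rw [hbot] at hy
    have hy0 : (show R from y) = 0 := (Submodule.mem_bot R).1 hy
    rw [hy0, zero_smul]
    exact zero_mem _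

theorem tensorUnit_mem_iff (M : GradedMod R) (n : ℤ) {j k : ℤ} (hk : k = j + n) {x : M.carrier} :
    M.tensorUnit n x ∈ (M.tensorGM (unitGM R n)).grading k ↔ x ∈ M.grading j :=
  ⟨fun h => by simpa using M.tensorUnit_symm_mem n hk h, M.tensorUnit_mem n hk⟩

theorem map_tensorUnit {M N : GradedMod R} (m n : ℤ) (f : M.carrier →ₗ[R] N.carrier)
    (g : (unitGM R m).carrier →ₗ[R] (unitGM R n).carrier)
    (hg : g (1 : R) = (1 : R)) (x : M.carrier) :
    TensorProduct.map f g (M.tensorUnit m x) = N.tensorUnit n (f x) := by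
  exact (TensorProduct.map_tmul f g x (1 : R)).trans (congrArg (fun y => f x ⊗ₜ[R] y) hg)

theorem map_id_tensorUnit {M N : GradedMod R} (n : ℤ) (f : M.carrier →ₗ[R] N.carrier)
    (x : M.carrier) :
    TensorProduct.map f LinearMap.id (M.tensorUnit n x) = N.tensorUnit n (f x) :=
  map_tensorUnit n n f LinearMap.id rfl x

theorem map_zero_tensorUnit {M N : GradedMod R} (m n : ℤ) (f : M.carrier →ₗ[R] N.carrier)
    (x : M.carrier) :
    TensorProduct.map f (0 : (unitGM R m).carrier →ₗ[R] (unitGM R n).carrier)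
      (M.tensorUnit m x) = 0 := by
  rw [TensorProduct.map_zero_right, LinearMap.zero_apply]

end GradedMod

namespace SCData

open GradedMod

variable (S : SCData R)
  (eC : S.Irr.carrier →ₗ[R] S.Irr.carrier) (eR : S.Red.carrier →ₗ[R] S.Red.carrier)

/-- The irreducible summand of `ΣC~` as a product. -/
def suspIrrEquiv : (S.Irr.carrier × S.Red.carrier) ≃ₗ[R] S.susp.Irr.carrier :=
  LinearEquiv.refl R _

/-- The reducible summand of `ΣC~` as that of `C~`. -/
def suspRedEquiv : S.Red.carrier ≃ₗ[R] S.susp.Red.carrier :=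
  LinearEquiv.refl R _

/-- The irreducible summand of `C~ ⊗ O~(1)` without tensor products. -/
noncomputable def tensorIrrEquiv :
    (S.Irr.carrier × S.Irr.carrier × S.Irr.carrier × S.Red.carrier) ≃ₗ[R]
      (tensorRep S (O1 R) eC eR).Irr.carrier :=
  (S.Irr.tensorUnit 1).prodCongr ((S.Irr.tensorUnit 1).prodCongr
    ((S.Irr.tensorUnit 0).prodCongr (S.Red.tensorUnit 1)))

/-- The reducible summand of `C~ ⊗ O~(1)` as that of `C~`. -/
noncomputable def tensorRedEquiv :
    S.Red.carrier ≃ₗ[R] (tensorRep S (O1 R) eC eR).Red.carrier :=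
  S.Red.tensorUnit 0

theorem susp_d_apply (x : S.Irr.carrier) (ρ : S.Red.carrier) :
    S.susp.d (S.suspIrrEquiv (x, ρ)) = S.suspIrrEquiv (S.d x - S.δ₂ ρ, -S.r ρ) := rfl

theorem susp_v_apply (x : S.Irr.carrier) (ρ : S.Red.carrier) :
    S.susp.v (S.suspIrrEquiv (x, ρ)) = S.suspIrrEquiv (S.v x, S.δ₁ x) := rfl

theorem susp_δ₁_apply (x : S.Irr.carrier) (ρ : S.Red.carrier) :
    S.susp.δ₁ (S.suspIrrEquiv (x, ρ)) = S.suspRedEquiv ρ := rfl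

theorem susp_δ₂_apply (ρ : S.Red.carrier) :
    S.susp.δ₂ (S.suspRedEquiv ρ) = S.suspIrrEquiv (S.v (S.δ₂ ρ), S.δ₁ (S.δ₂ ρ)) := rfl

theorem susp_r_apply (ρ : S.Red.carrier) :
    S.susp.r (S.suspRedEquiv ρ) = S.suspRedEquiv (S.r ρ) := rfl

theorem tensor_d_apply (a b c : S.Irr.carrier) (e : S.Red.carrier) :
    (tensorRep S (O1 R) eC eR).d (S.tensorIrrEquiv eC eR (a, b, c, e)) =
      S.tensorIrrEquiv eC eR
        (S.d a, -eC (S.v a) + S.d b - eC (S.δ₂ e), eC a + S.d c, S.δ₁ a + S.r e) := by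
  refine Prod.ext ?_ (Prod.ext ?_ (Prod.ext ?_ ?_))
  · change TensorProduct.map S.d LinearMap.id (S.Irr.tensorUnit 1 a) +
      TensorProduct.map eC 0 (S.Irr.tensorUnit 1 a) = S.Irr.tensorUnit 1 (S.d a)
    rw [map_id_tensorUnit, map_zero_tensorUnit, add_zero]
  · change TensorProduct.map (-(eC ∘ₗ S.v)) LinearMap.id (S.Irr.tensorUnit 1 a) +
      TensorProduct.map eC 0 (S.Irr.tensorUnit 1 a) +
      TensorProduct.map S.d LinearMap.id (S.Irr.tensorUnit 1 b) -
      TensorProduct.map eC 0 (S.Irr.tensorUnit 1 b) +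
      TensorProduct.map eC 0 (S.Irr.tensorUnit 0 c) +
      TensorProduct.map (-(eC ∘ₗ S.δ₂)) LinearMap.id (S.Red.tensorUnit 1 e) =
        S.Irr.tensorUnit 1 (-eC (S.v a) + S.d b - eC (S.δ₂ e))
    simp only [map_id_tensorUnit, map_zero_tensorUnit,
      add_zero, sub_zero, map_add, map_sub, ← sub_eq_add_neg, map_neg, LinearMap.neg_apply,
      LinearMap.comp_apply]
  · refine Eq.trans ?_ ((add_zero _).trans (map_add (S.Irr.tensorUnit 0) (eC a) (S.d c)).symm)
    exact congrArg₂ (· + ·) (congrArg₂ (· + ·) (map_tensorUnit 1 0 eC LinearMap.id rfl a)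
      (map_id_tensorUnit 0 S.d c)) (map_zero_tensorUnit 0 0 eC c)
  · change TensorProduct.map S.δ₁ LinearMap.id (S.Irr.tensorUnit 1 a) +
      TensorProduct.map eR 0 (S.Red.tensorUnit 1 e) +
      TensorProduct.map S.r LinearMap.id (S.Red.tensorUnit 1 e) =
        S.Red.tensorUnit 1 (S.δ₁ a + S.r e)
    simp only [map_id_tensorUnit, map_zero_tensorUnit,
      add_zero, map_add]

theorem tensor_v_apply (a b c : S.Irr.carrier) (e : S.Red.carrier) :
    (tensorRep S (O1 R) eC eR).v (S.tensorIrrEquiv eC eR (a, b, c, e)) =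
      S.tensorIrrEquiv eC eR (S.v a + S.δ₂ e, S.v b, S.v c, eR (S.δ₁ b)) := by
  refine Prod.ext ?_ (Prod.ext ?_ (Prod.ext ?_ ?_))
  · change TensorProduct.map S.v LinearMap.id (S.Irr.tensorUnit 1 a) +
      TensorProduct.map S.δ₂ LinearMap.id (S.Red.tensorUnit 1 e) =
        S.Irr.tensorUnit 1 (S.v a + S.δ₂ e)
    simp only [map_id_tensorUnit, map_add]
  · exact map_id_tensorUnit 1 S.v b
  · exact map_id_tensorUnit 0 S.v c
  · change TensorProduct.map (eR ∘ₗ S.δ₁) LinearMap.id (S.Irr.tensorUnit 1 b) +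
      TensorProduct.map LinearMap.id 0 (S.Red.tensorUnit 1 e) = S.Red.tensorUnit 1 (eR (S.δ₁ b))
    simp only [map_id_tensorUnit, map_zero_tensorUnit,
      add_zero, LinearMap.comp_apply]

theorem tensor_δ₁_apply (a b c : S.Irr.carrier) (e : S.Red.carrier) :
    (tensorRep S (O1 R) eC eR).δ₁ (S.tensorIrrEquiv eC eR (a, b, c, e)) =
      S.tensorRedEquiv eC eR (S.δ₁ c + eR e) := by
  refine Eq.trans ?_ (map_add (S.Red.tensorUnit 0) (S.δ₁ c) (eR e)).symm
  exact congrArg₂ (· + ·) (map_id_tensorUnit 0 S.δ₁ c)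
    (map_tensorUnit 1 0 eR LinearMap.id rfl e)

theorem tensor_δ₂_apply (ρ : S.Red.carrier) :
    (tensorRep S (O1 R) eC eR).δ₂ (S.tensorRedEquiv eC eR ρ) =
      S.tensorIrrEquiv eC eR (0, 0, S.δ₂ ρ, 0) := by
  refine Prod.ext ?_ (Prod.ext ?_ (Prod.ext ?_ ?_))
  · exact (map_zero (S.Irr.tensorUnit 1)).symm
  · exact (map_zero (S.Irr.tensorUnit 1)).symm
  · exact map_id_tensorUnit 0 S.δ₂ ρ
  · change TensorProduct.map LinearMap.id 0 (S.Red.tensorUnit 0 ρ) = S.Red.tensorUnit 1 0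
    rw [map_zero_tensorUnit, map_zero]

theorem tensor_r_apply (ρ : S.Red.carrier) :
    (tensorRep S (O1 R) eC eR).r (S.tensorRedEquiv eC eR ρ) =
      S.tensorRedEquiv eC eR (S.r ρ) := by
  change TensorProduct.map S.r LinearMap.id (S.Red.tensorUnit 0 ρ) +
    TensorProduct.map eR 0 (S.Red.tensorUnit 0 ρ) = S.Red.tensorUnit 0 (S.r ρ)
  rw [map_id_tensorUnit, map_zero_tensorUnit, add_zero]

/-- The morphism `ΣC~ → C~ ⊗ O~(1)`. -/
noncomputable def suspToTensor : SMap S.susp (tensorRep S (O1 R) eC eR) where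
  lam := (S.tensorIrrEquiv eC eR).toLinearMap ∘ₗ
    quad 0 (LinearMap.fst R _ _) 0 (eR ∘ₗ LinearMap.snd R _ _) ∘ₗ S.suspIrrEquiv.symm.toLinearMap
  mu := 0
  del1 := 0
  del2 := (S.tensorIrrEquiv eC eR).toLinearMap ∘ₗ
    quad (eC ∘ₗ S.δ₂) 0 0 0 ∘ₗ S.suspRedEquiv.symm.toLinearMap
  rho := (S.tensorRedEquiv eC eR).toLinearMap ∘ₗ S.suspRedEquiv.symm.toLinearMap

/-- The morphism `C~ ⊗ O~(1) → ΣC~`. -/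
noncomputable def tensorToSusp : SMap (tensorRep S (O1 R) eC eR) S.susp where
  lam := S.suspIrrEquiv.toLinearMap ∘ₗ
    LinearMap.prod (qj₂ + S.v ∘ₗ qj₃) (eR ∘ₗ qj₄ + S.δ₁ ∘ₗ qj₃) ∘ₗ
      (S.tensorIrrEquiv eC eR).symm.toLinearMap
  mu := 0
  del1 := 0
  del2 := 0
  rho := S.suspRedEquiv.toLinearMap ∘ₗ (S.tensorRedEquiv eC eR).symm.toLinearMap

/-- The homotopy on `C~ ⊗ O~(1)` cancelling `C ⊗ C'` against `C ⊗ 𝖱'`. -/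
noncomputable def tensorHtpy :
    SMap (tensorRep S (O1 R) eC eR) (tensorRep S (O1 R) eC eR) where
  lam := (S.tensorIrrEquiv eC eR).toLinearMap ∘ₗ quad (-(eC ∘ₗ qj₃)) 0 0 0 ∘ₗ
    (S.tensorIrrEquiv eC eR).symm.toLinearMap
  mu := 0
  del1 := 0
  del2 := 0
  rho := 0

theorem suspToTensor_lam_apply (x : S.Irr.carrier) (ρ : S.Red.carrier) :
    (S.suspToTensor eC eR).lam (S.suspIrrEquiv (x, ρ)) =
      S.tensorIrrEquiv eC eR (0, x, 0, eR ρ) := rfl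

theorem suspToTensor_del2_apply (ρ : S.Red.carrier) :
    (S.suspToTensor eC eR).del2 (S.suspRedEquiv ρ) =
      S.tensorIrrEquiv eC eR (eC (S.δ₂ ρ), 0, 0, 0) := rfl

theorem suspToTensor_rho_apply (ρ : S.Red.carrier) :
    (S.suspToTensor eC eR).rho (S.suspRedEquiv ρ) = S.tensorRedEquiv eC eR ρ := rfl

theorem tensorToSusp_lam_apply (a b c : S.Irr.carrier) (e : S.Red.carrier) :
    (S.tensorToSusp eC eR).lam (S.tensorIrrEquiv eC eR (a, b, c, e)) =
      S.suspIrrEquiv (b + S.v c, eR e + S.δ₁ c) := by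
  simp only [tensorToSusp, LinearMap.comp_apply, LinearEquiv.coe_coe,
    LinearEquiv.symm_apply_apply]
  rfl

theorem tensorToSusp_rho_apply (ρ : S.Red.carrier) :
    (S.tensorToSusp eC eR).rho (S.tensorRedEquiv eC eR ρ) = S.suspRedEquiv ρ := by
  simp only [tensorToSusp, LinearMap.comp_apply, LinearEquiv.coe_coe,
    LinearEquiv.symm_apply_apply]

theorem tensorHtpy_lam_apply (a b c : S.Irr.carrier) (e : S.Red.carrier) :
    (S.tensorHtpy eC eR).lam (S.tensorIrrEquiv eC eR (a, b, c, e)) =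
      S.tensorIrrEquiv eC eR (-eC c, 0, 0, 0) := by
  simp only [tensorHtpy, LinearMap.comp_apply, LinearEquiv.coe_coe,
    LinearEquiv.symm_apply_apply]
  rfl

theorem suspIrrEquiv_mem_iff (j : ℤ) (x : S.Irr.carrier) (ρ : S.Red.carrier) :
    S.suspIrrEquiv (x, ρ) ∈ S.susp.Irr.grading j ↔
      x ∈ S.Irr.grading (j - 2) ∧ ρ ∈ S.Red.grading (j - 1) := Iff.rfl

theorem suspRedEquiv_mem_iff (j : ℤ) (ρ : S.Red.carrier) :
    S.suspRedEquiv ρ ∈ S.susp.Red.grading j ↔ ρ ∈ S.Red.grading j := Iff.rfl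

theorem tensorIrrEquiv_mem_iff (j : ℤ) (a b c : S.Irr.carrier) (e : S.Red.carrier) :
    S.tensorIrrEquiv eC eR (a, b, c, e) ∈ (tensorRep S (O1 R) eC eR).Irr.grading j ↔
      a ∈ S.Irr.grading (j - 1) ∧ b ∈ S.Irr.grading (j - 2) ∧ c ∈ S.Irr.grading j ∧
        e ∈ S.Red.grading (j - 1) :=
  and_congr (S.Irr.tensorUnit_mem_iff 1 (by ring)) <|
    and_congr (S.Irr.tensorUnit_mem_iff 1 (by ring)) <|
      and_congr (S.Irr.tensorUnit_mem_iff 0 (by ring)) (S.Red.tensorUnit_mem_iff 1 (by ring))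

theorem tensorRedEquiv_mem_iff (j : ℤ) (ρ : S.Red.carrier) :
    S.tensorRedEquiv eC eR ρ ∈ (tensorRep S (O1 R) eC eR).Red.grading j ↔ ρ ∈ S.Red.grading j :=
  S.Red.tensorUnit_mem_iff 0 (by ring)

variable {S eC eR}

theorem suspToTensor_degreesAt (hS : S.Degrees) (heC : S.Irr.IsSign eC) (heR : S.Red.IsSign eR) :
    (S.suspToTensor eC eR).DegreesAt 0 := by
  obtain ⟨-, -, -, hδ₂, -⟩ := hS
  refine ⟨?_, IsDeg.zero _ _ _, IsDeg.zero _ _ _, ?_, ?_⟩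
  · rintro i _ ⟨z, hz, rfl⟩
    obtain ⟨⟨x, ρ⟩, rfl⟩ := S.suspIrrEquiv.surjective z
    obtain ⟨hx, hρ⟩ := (S.suspIrrEquiv_mem_iff i x ρ).1 hz
    rw [suspToTensor_lam_apply, tensorIrrEquiv_mem_iff, add_zero]
    exact ⟨zero_mem _, hx, zero_mem _, heR.mem hρ⟩
  · rintro i _ ⟨z, hz, rfl⟩
    obtain ⟨ρ, rfl⟩ := S.suspRedEquiv.surjective z
    have hρ := (S.suspRedEquiv_mem_iff i ρ).1 hz
    rw [suspToTensor_del2_apply, tensorIrrEquiv_mem_iff]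
    exact ⟨heC.mem (hδ₂.mem (by ring) hρ), zero_mem _, zero_mem _, zero_mem _⟩
  · rintro i _ ⟨z, hz, rfl⟩
    obtain ⟨ρ, rfl⟩ := S.suspRedEquiv.surjective z
    rw [suspToTensor_rho_apply, tensorRedEquiv_mem_iff, add_zero]
    exact (S.suspRedEquiv_mem_iff i ρ).1 hz

theorem tensorToSusp_degreesAt (hS : S.Degrees) (heR : S.Red.IsSign eR) :
    (S.tensorToSusp eC eR).DegreesAt 0 := by
  obtain ⟨-, hv, hδ₁, -, -⟩ := hS
  refine ⟨?_, IsDeg.zero _ _ _, IsDeg.zero _ _ _, IsDeg.zero _ _ _, ?_⟩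
  · rintro i _ ⟨z, hz, rfl⟩
    obtain ⟨⟨a, b, c, e⟩, rfl⟩ := (S.tensorIrrEquiv eC eR).surjective z
    obtain ⟨-, hb, hc, he⟩ := (S.tensorIrrEquiv_mem_iff eC eR i a b c e).1 hz
    rw [tensorToSusp_lam_apply, suspIrrEquiv_mem_iff, add_zero]
    exact ⟨add_mem hb (hv.mem (by ring) hc), add_mem (heR.mem he) (hδ₁.mem (by ring) hc)⟩
  · rintro i _ ⟨z, hz, rfl⟩
    obtain ⟨ρ, rfl⟩ := (S.tensorRedEquiv eC eR).surjective z
    rw [tensorToSusp_rho_apply, suspRedEquiv_mem_iff, add_zero]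
    exact (S.tensorRedEquiv_mem_iff eC eR i ρ).1 hz

theorem tensorHtpy_degreesAt (heC : S.Irr.IsSign eC) : (S.tensorHtpy eC eR).DegreesAt 1 := by
  refine ⟨?_, IsDeg.zero _ _ _, IsDeg.zero _ _ _, IsDeg.zero _ _ _, IsDeg.zero _ _ _⟩
  rintro i _ ⟨z, hz, rfl⟩
  obtain ⟨⟨a, b, c, e⟩, rfl⟩ := (S.tensorIrrEquiv eC eR).surjective z
  obtain ⟨-, -, hc, -⟩ := (S.tensorIrrEquiv_mem_iff eC eR i a b c e).1 hz
  rw [tensorHtpy_lam_apply, tensorIrrEquiv_mem_iff, add_sub_cancel_right]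
  exact ⟨neg_mem (heC.mem hc), zero_mem _, zero_mem _, zero_mem _⟩

theorem Relations.apply (h : S.Relations) :
    (∀ x, S.δ₁ (S.d x) = -S.r (S.δ₁ x)) ∧ (∀ ρ, S.d (S.δ₂ ρ) = S.δ₂ (S.r ρ)) ∧
      ∀ x, S.d (S.v x) = S.v (S.d x) + S.δ₂ (S.δ₁ x) := by
  obtain ⟨-, h₁, h₂, hv, -⟩ := h
  refine ⟨fun x => ?_, fun ρ => ?_, fun x => ?_⟩
  · exact eq_neg_of_add_eq_zero_left (LinearMap.congr_fun h₁ x)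
  · exact sub_eq_zero.1 (LinearMap.congr_fun h₂ ρ)
  · exact sub_eq_iff_eq_add'.1 (sub_eq_zero.1 (LinearMap.congr_fun hv x))

theorem IsSComplex.sign_apply (hS : S.IsSComplex) (heC : S.Irr.IsSign eC)
    (heR : S.Red.IsSign eR) :
    (∀ x, S.d (eC x) = -eC (S.d x)) ∧ (∀ x, S.v (eC x) = eC (S.v x)) ∧
      (∀ x, S.δ₁ (eC x) = -eR (S.δ₁ x)) ∧ (∀ ρ, S.δ₂ (eR ρ) = eC (S.δ₂ ρ)) ∧
        ∀ ρ, S.r (eR ρ) = -eR (S.r ρ) := by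
  obtain ⟨hC, hR, ⟨hd, hv, hδ₁, hδ₂, hr⟩, -⟩ := hS
  exact ⟨heC.apply_of_odd hC heC (by decide) hd, heC.apply_of_even hC heC (by decide) hv,
    heC.apply_of_odd hC heR (by decide) hδ₁, heR.apply_of_even hR heC (by decide) hδ₂,
    heR.apply_of_odd hR heR (by decide) hr⟩

theorem suspToTensor_isMor (hS : S.IsSComplex) (heC : S.Irr.IsSign eC)
    (heR : S.Red.IsSign eR) : (S.suspToTensor eC eR).IsMor := by
  have hCC := heC.apply_apply hS.1
  have hRR := heR.apply_apply hS.2.1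
  obtain ⟨ed, ev, eδ₁, eδ₂, er⟩ := hS.sign_apply heC heR
  obtain ⟨-, h₂, -⟩ := hS.2.2.2.apply
  have hmu : (S.suspToTensor eC eR).mu = 0 := rfl
  have hdel1 : (S.suspToTensor eC eR).del1 = 0 := rfl
  refine ⟨?_, ?_, ?_, ?_, ?_⟩ <;> refine LinearMap.ext fun z => ?_
  · obtain ⟨⟨x, ρ⟩, rfl⟩ := S.suspIrrEquiv.surjective z
    apply (S.tensorIrrEquiv eC eR).symm.injective
    simp [susp_d_apply, suspToTensor_lam_apply, tensor_d_apply, eδ₂, er, hCC]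
  · obtain ⟨⟨x, ρ⟩, rfl⟩ := S.suspIrrEquiv.surjective z
    apply (S.tensorRedEquiv eC eR).symm.injective
    simp [hdel1, susp_δ₁_apply, suspToTensor_lam_apply, suspToTensor_rho_apply, tensor_δ₁_apply,
      hRR]
  · obtain ⟨ρ, rfl⟩ := S.suspRedEquiv.surjective z
    apply (S.tensorIrrEquiv eC eR).symm.injective
    simp [suspToTensor_lam_apply, suspToTensor_rho_apply, suspToTensor_del2_apply, tensor_δ₂_apply,
      susp_δ₂_apply, susp_r_apply, tensor_d_apply, hCC, ed, ev, eδ₁, h₂]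
  · obtain ⟨⟨x, ρ⟩, rfl⟩ := S.suspIrrEquiv.surjective z
    apply (S.tensorIrrEquiv eC eR).symm.injective
    simp [hmu, hdel1, susp_δ₁_apply, susp_v_apply, suspToTensor_lam_apply,
      suspToTensor_del2_apply, tensor_v_apply, eδ₂]
  · obtain ⟨ρ, rfl⟩ := S.suspRedEquiv.surjective z
    simp [suspToTensor_rho_apply, susp_r_apply, tensor_r_apply]

theorem tensorToSusp_isMor (hS : S.IsSComplex) (heC : S.Irr.IsSign eC)
    (heR : S.Red.IsSign eR) : (S.tensorToSusp eC eR).IsMor := by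
  have hRR := heR.apply_apply hS.2.1
  obtain ⟨-, ev, eδ₁, eδ₂, er⟩ := hS.sign_apply heC heR
  obtain ⟨h₁, -, hv⟩ := hS.2.2.2.apply
  have hmu : (S.tensorToSusp eC eR).mu = 0 := rfl
  have hdel1 : (S.tensorToSusp eC eR).del1 = 0 := rfl
  have hdel2 : (S.tensorToSusp eC eR).del2 = 0 := rfl
  refine ⟨?_, ?_, ?_, ?_, ?_⟩ <;> refine LinearMap.ext fun z => ?_
  · obtain ⟨⟨a, b, c, e⟩, rfl⟩ := (S.tensorIrrEquiv eC eR).surjective z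
    apply S.suspIrrEquiv.symm.injective
    simp [susp_d_apply, tensorToSusp_lam_apply, tensor_d_apply, ev, eδ₁, eδ₂, er, h₁, hv]
    constructor <;> abel
  · obtain ⟨⟨a, b, c, e⟩, rfl⟩ := (S.tensorIrrEquiv eC eR).surjective z
    apply S.suspRedEquiv.symm.injective
    simp [hdel1, susp_δ₁_apply, tensorToSusp_lam_apply, tensorToSusp_rho_apply, tensor_δ₁_apply,
      add_comm]
  · obtain ⟨ρ, rfl⟩ := (S.tensorRedEquiv eC eR).surjective z
    apply S.suspIrrEquiv.symm.injective
    simp [hdel2, tensorToSusp_lam_apply, tensorToSusp_rho_apply, tensor_δ₂_apply, susp_δ₂_apply]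
  · obtain ⟨⟨a, b, c, e⟩, rfl⟩ := (S.tensorIrrEquiv eC eR).surjective z
    apply S.suspIrrEquiv.symm.injective
    simp [hmu, hdel1, hdel2, susp_v_apply, tensorToSusp_lam_apply, tensor_v_apply, hRR]
  · obtain ⟨ρ, rfl⟩ := (S.tensorRedEquiv eC eR).surjective z
    simp [tensorToSusp_rho_apply, susp_r_apply, tensor_r_apply]

theorem tensorToSusp_comp_suspToTensor (hS : S.IsSComplex) (heR : S.Red.IsSign eR) :
    (S.tensorToSusp eC eR).comp (S.suspToTensor eC eR) = idMap S.susp := by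
  have hRR := heR.apply_apply hS.2.1
  have hlam : (S.tensorToSusp eC eR).lam ∘ₗ (S.suspToTensor eC eR).lam = LinearMap.id := by
    refine LinearMap.ext fun z => ?_
    obtain ⟨⟨x, ρ⟩, rfl⟩ := S.suspIrrEquiv.surjective z
    simp [suspToTensor_lam_apply, tensorToSusp_lam_apply, hRR]
  have hdel2 : (S.tensorToSusp eC eR).lam ∘ₗ (S.suspToTensor eC eR).del2 = 0 := by
    refine LinearMap.ext fun z => ?_
    obtain ⟨ρ, rfl⟩ := S.suspRedEquiv.surjective z
    apply S.suspIrrEquiv.symm.injective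
    simp [suspToTensor_del2_apply, tensorToSusp_lam_apply]
  have hrho : (S.tensorToSusp eC eR).rho ∘ₗ (S.suspToTensor eC eR).rho = LinearMap.id := by
    refine LinearMap.ext fun z => ?_
    obtain ⟨ρ, rfl⟩ := S.suspRedEquiv.surjective z
    simp [suspToTensor_rho_apply, tensorToSusp_rho_apply]
  simp only [SMap.comp, idMap, hlam, hdel2, hrho, SMap.mk.injEq, true_and, and_true]
  simp [suspToTensor, tensorToSusp]

theorem isHtpyFrom_tensorHtpy (hS : S.IsSComplex) (heC : S.Irr.IsSign eC)
    (heR : S.Red.IsSign eR) :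
    SMap.IsHtpyFrom (S.tensorHtpy eC eR) ((S.suspToTensor eC eR).comp (S.tensorToSusp eC eR))
      (idMap (tensorRep S (O1 R) eC eR)) := by
  have hCC := heC.apply_apply hS.1
  have hRR := heR.apply_apply hS.2.1
  obtain ⟨ed, ev, eδ₁, -, -⟩ := hS.sign_apply heC heR
  have hf : (S.suspToTensor eC eR).mu = 0 ∧ (S.suspToTensor eC eR).del1 = 0 := ⟨rfl, rfl⟩
  have hg : (S.tensorToSusp eC eR).mu = 0 ∧ (S.tensorToSusp eC eR).del1 = 0 ∧
    (S.tensorToSusp eC eR).del2 = 0 := ⟨rfl, rfl, rfl⟩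
  have hK : (S.tensorHtpy eC eR).mu = 0 ∧ (S.tensorHtpy eC eR).del1 = 0 ∧
    (S.tensorHtpy eC eR).del2 = 0 ∧ (S.tensorHtpy eC eR).rho = 0 := ⟨rfl, rfl, rfl, rfl⟩
  simp only [SMap.IsHtpyFrom, SMap.comp, idMap, hf, hg, hK]
  refine ⟨?_, ?_, ?_, ?_, ?_⟩ <;> refine LinearMap.ext fun z => ?_
  · obtain ⟨⟨a, b, c, e⟩, rfl⟩ := (S.tensorIrrEquiv eC eR).surjective z
    apply (S.tensorIrrEquiv eC eR).symm.injective
    simp [tensorHtpy_lam_apply, tensor_d_apply, tensorToSusp_lam_apply, suspToTensor_lam_apply,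
      hCC, hRR, ed, ev, eδ₁]
  · obtain ⟨⟨a, b, c, e⟩, rfl⟩ := (S.tensorIrrEquiv eC eR).surjective z
    apply (S.tensorRedEquiv eC eR).symm.injective
    simp [tensorHtpy_lam_apply, tensor_δ₁_apply]
  · obtain ⟨ρ, rfl⟩ := (S.tensorRedEquiv eC eR).surjective z
    apply (S.tensorIrrEquiv eC eR).symm.injective
    simp [tensorHtpy_lam_apply, tensor_δ₂_apply, tensorToSusp_rho_apply, suspToTensor_del2_apply]
  · obtain ⟨⟨a, b, c, e⟩, rfl⟩ := (S.tensorIrrEquiv eC eR).surjective z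
    apply (S.tensorIrrEquiv eC eR).symm.injective
    simp [tensorHtpy_lam_apply, tensor_v_apply, ev]
  · obtain ⟨ρ, rfl⟩ := (S.tensorRedEquiv eC eR).surjective z
    simp [tensorToSusp_rho_apply, suspToTensor_rho_apply]

end SCData

namespace SMap

theorem isHtpyFrom_zero {S T : SCData R} (f : SMap S T) : IsHtpyFrom ⟨0, 0, 0, 0, 0⟩ f f := by
  simp [IsHtpyFrom]

end SMap

/-- For any `S`-complex `C~`, the suspension `ΣC~` is `S`-chain homotopy
equivalent to the tensor product `C~ ⊗ O~(1)`. -/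
theorem susp_homotopyEquiv_tensor_O1 {R : Type u} [CommRing R] (S : SCData R)
    (hS : S.IsSComplex)
    (eC : S.Irr.carrier →ₗ[R] S.Irr.carrier) (eR : S.Red.carrier →ₗ[R] S.Red.carrier)
    (heC : S.Irr.IsSign eC) (heR : S.Red.IsSign eR) :
    SHomotopyEquiv S.susp (tensorRep S (O1 R) eC eR) := by
  refine ⟨S.suspToTensor eC eR, S.tensorToSusp eC eR, ⟨0, 0, 0, 0, 0⟩, S.tensorHtpy eC eR,
    SCData.suspToTensor_isMor hS heC heR, SCData.suspToTensor_degreesAt hS.2.2.1 heC heR,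
    SCData.tensorToSusp_isMor hS heC heR, SCData.tensorToSusp_degreesAt hS.2.2.1 heR,
    ⟨.zero _ _ _, .zero _ _ _, .zero _ _ _, .zero _ _ _, .zero _ _ _⟩, ?_,
    SCData.tensorHtpy_degreesAt heC, SCData.isHtpyFrom_tensorHtpy hS heC heR⟩
  rw [SCData.tensorToSusp_comp_suspToTensor hS heR]
  exact SMap.isHtpyFrom_zero _
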